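/- arXiv:1912.12529 — 7 statements merged into one kernel-verified Lean document; each statement's English description precedes it below -/
import Mathlib

section
/- Sumset property: For all natural numbers t and Δ, if A₁ (t,Δ)-approximates B₁ and A₂ (t,Δ)-approximates B₂, then the capped sumset A₁ +_t A₂ (t,Δ)-approximates the capped sumset B₁ +_t B₂. -/
/-- `A` (t,Δ)-approximates `B`: `A ⊆ B ⊆ [t]` and every `b ∈ B` has lower and upper
approximations in `A ∪ {t+1}` within distance `Δ` of each other. -/
def Approximates (t Δ : ℕ) (A B : Set ℕ) : Prop :=
  A ⊆ B ∧ B ⊆ Set.Iic t ∧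
  ∀ b ∈ B, ∃ am ∈ insert (t + 1) A, ∃ ap ∈ insert (t + 1) A,
    am ≤ b ∧ b ≤ ap ∧ ap - am ≤ Δ

/-- The capped sumset `A +_t B = (A + B) ∩ [t]`. -/
def cappedSumset (t : ℕ) (A B : Set ℕ) : Set ℕ :=
  {x | ∃ a ∈ A, ∃ b ∈ B, x = a + b} ∩ Set.Iic t

theorem sumset_property (t Δ : ℕ) (A₁ B₁ A₂ B₂ : Set ℕ)
    (h₁ : Approximates t Δ A₁ B₁) (h₂ : Approximates t Δ A₂ B₂) :
    Approximates t Δ (cappedSumset t A₁ A₂) (cappedSumset t B₁ B₂) := by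
  obtain ⟨hA1, hB1, h1⟩ := h₁
  obtain ⟨hA2, hB2, h2⟩ := h₂
  refine ⟨?_, fun x hx => hx.2, ?_⟩
  · rintro x ⟨⟨a, ha, b, hb, rfl⟩, hx⟩
    exact ⟨⟨a, hA1 ha, b, hA2 hb, rfl⟩, hx⟩
  · rintro x ⟨⟨b1, hb1, b2, hb2, rfl⟩, hx⟩
    simp only [Set.mem_Iic] at hx
    obtain ⟨m1, hm1, p1, hp1, k1, l1, d1⟩ := h1 b1 hb1
    obtain ⟨m2, hm2, p2, hp2, k2, l2, d2⟩ := h2 b2 hb2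
    have hm1' : m1 ∈ A₁ := hm1.resolve_left (by omega)
    have hm2' : m2 ∈ A₂ := hm2.resolve_left (by omega)
    have key : ∀ a ∈ A₁, ∀ b ∈ A₂, a + b ≤ t →
        a + b ∈ insert (t + 1) (cappedSumset t A₁ A₂) :=
      fun a ha b hb h => Or.inr ⟨⟨a, ha, b, hb, rfl⟩, h⟩
    by_cases hc : b1 + b2 ≤ p1 + m2
    · refine ⟨m1 + m2, key _ hm1' _ hm2' (by omega), ?_⟩
      by_cases ht : p1 + m2 ≤ t
      · exact ⟨p1 + m2, key _ (hp1.resolve_left (by omega)) _ hm2' ht,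
          by omega, hc, by omega⟩
      · exact ⟨t + 1, Or.inl rfl, by omega, by omega, by omega⟩
    · have hp1' : p1 ∈ A₁ := hp1.resolve_left (by omega)
      refine ⟨p1 + m2, key _ hp1' _ hm2' (by omega), ?_⟩
      by_cases ht : p1 + p2 ≤ t
      · exact ⟨p1 + p2, key _ hp1' _ (hp2.resolve_left (by omega)) ht,
          by omega, by omega, by omega⟩
      · exact ⟨t + 1, Or.inl rfl, by omega, by omega, by omega⟩
end

section
/- Sparsification: For all natural numbers t and Δ and every set B ⊆ [t], there exists a set A ⊆ B such that A is Δ-sparse and A (t,Δ)-approximates B. -/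
/-- `A` is Δ-sparse: every interval `[x, x+Δ]` contains at most two elements of `A`. -/
def DeltaSparse (Δ : ℕ) (A : Set ℕ) : Prop :=
  ∀ x : ℕ, (A ∩ Set.Icc x (x + Δ)).encard ≤ 2

theorem approx_remove (t Δ : ℕ) (A B : Set ℕ) (h : Approximates t Δ A B) (x y z : ℕ)
    (hx : x ∈ A) (hz : z ∈ A) (hxy : x < y) (hyz : y < z) (hd : z ≤ x + Δ) :
    Approximates t Δ (A \ {y}) B := by
  obtain ⟨h1, h2, h3⟩ := h
  refine ⟨Set.sdiff_subset.trans h1, h2, fun b hb => ?_⟩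
  obtain ⟨p, hp, q, hq, hpb, hbq, hpq⟩ := h3 b hb
  have hx' : x ∈ insert (t + 1) (A \ {y}) := Or.inr ⟨hx, by simp; omega⟩
  have hz' : z ∈ insert (t + 1) (A \ {y}) := Or.inr ⟨hz, by simp; omega⟩
  have key : ∀ w ∈ insert (t + 1) A, w ≠ y → w ∈ insert (t + 1) (A \ {y}) := by
    rintro w (hw | hw) hwy
    · exact Or.inl hw
    · exact Or.inr ⟨hw, by simpa using hwy⟩
  by_cases hb1 : x ≤ b ∧ b ≤ z
  · exact ⟨x, hx', z, hz', hb1.1, hb1.2, by omega⟩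
  by_cases hpy : p = y
  · exact ⟨z, hz', q, key q hq (by omega), by omega, hbq, by omega⟩
  by_cases hqy : q = y
  · exact ⟨p, key p hp hpy, x, hx', hpb, by omega, by omega⟩
  exact ⟨p, key p hp hpy, q, key q hq hqy, hpb, hbq, hpq⟩

theorem sparsification (t Δ : ℕ) (B : Set ℕ) (hB : B ⊆ Set.Iic t) :
    ∃ A ⊆ B, DeltaSparse Δ A ∧ Approximates t Δ A B := by
  have hfin : {A : Set ℕ | Approximates t Δ A B}.Finite :=
    ((Set.finite_Iic t).subset hB).finite_subsets.subset fun A hA => hA.1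
  have hne : {A : Set ℕ | Approximates t Δ A B}.Nonempty :=
    ⟨B, subset_rfl, hB, fun b hb => ⟨b, Or.inr hb, b, Or.inr hb, le_rfl, le_rfl, by simp⟩⟩
  obtain ⟨A, hA, hmin⟩ := hfin.exists_minimal hne
  have hA' : Approximates t Δ A B := hA
  have no3 : ∀ x ∈ A, ∀ y ∈ A, ∀ z ∈ A, x < y → y < z → z ≤ x + Δ → False := by
    intro x hx y hy z hz hxy hyz hd
    have := hmin (approx_remove t Δ A B hA' x y z hx hz hxy hyz hd)
      Set.sdiff_subset hy
    exact this.2 rfl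
  refine ⟨A, hA'.1, fun n => ?_, hA'⟩
  by_contra hc
  have h3 : (3 : ℕ∞) ≤ (A ∩ Set.Icc n (n + Δ)).encard := by
    have := Order.add_one_le_of_lt (not_le.mp hc)
    exact le_trans (by norm_num) this
  obtain ⟨T, hT, hT3⟩ := Set.exists_subset_encard_eq h3
  obtain ⟨x, y, z, hxy, hxz, hyz, rfl⟩ := Set.encard_eq_three.mp hT3
  obtain ⟨hx, hx1, hx2⟩ := hT (show x ∈ ({x, y, z} : Set ℕ) by simp)
  obtain ⟨hy, hy1, hy2⟩ := hT (show y ∈ ({x, y, z} : Set ℕ) by simp)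
  obtain ⟨hz, hz1, hz2⟩ := hT (show z ∈ ({x, y, z} : Set ℕ) by simp)
  rcases lt_or_gt_of_ne hxy with h1 | h1 <;> rcases lt_or_gt_of_ne hxz with h2 | h2 <;>
    rcases lt_or_gt_of_ne hyz with h4 | h4
  · exact no3 x hx y hy z hz h1 h4 (by omega)
  · exact no3 x hx z hz y hy h2 h4 (by omega)
  · omega
  · exact no3 z hz x hx y hy h2 h1 (by omega)
  · exact no3 y hy x hx z hz h1 h2 (by omega)
  · omega
  · exact no3 y hy z hz x hx h4 h2 (by omega)
  · exact no3 z hz y hy x hx h4 h1 (by omega)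
end

section
/- Greedy prefix sums: Let t, Δ be natural numbers, let X ⊆ [t] be a finite set with max(X) ≤ Δ, and let x₁,…,xₙ be any enumeration of the elements of X (each element listed exactly once). Let P := { x₁ + ⋯ + x_j : 0 ≤ j ≤ n } ∩ [t] be the set of prefix sums that are at most t. Then P (t,Δ)-approximates S(X;t). -/
/-- `S(X;t)`: the set of all subset sums of `X` that are at most `t`. -/
def SubsetSums (X : Finset ℕ) (t : ℕ) : Set ℕ :=
  {s | ∃ Y ⊆ X, (∑ y ∈ Y, y) = s ∧ s ≤ t}

theorem greedy_prefix_sums (t Δ : ℕ) (X : Finset ℕ)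
    (hXt : ∀ x ∈ X, x ≤ t) (hXΔ : ∀ x ∈ X, x ≤ Δ)
    (l : List ℕ) (hnodup : l.Nodup) (hl : l.toFinset = X) :
    Approximates t Δ
      ({s | ∃ j ≤ l.length, (l.take j).sum = s} ∩ Set.Iic t)
      (SubsetSums X t) := by
  subst hl
  refine ⟨?_, ?_, ?_⟩
  · rintro s ⟨⟨j, hj, rfl⟩, hs⟩
    refine ⟨(l.take j).toFinset, ?_, ?_, hs⟩
    · intro x hx
      rw [List.mem_toFinset] at hx ⊢
      exact List.mem_of_mem_take hx
    · have h := List.sum_toFinset (fun x : ℕ => x) (hnodup.sublist (List.take_sublist j l))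
      simpa using h
  · rintro s ⟨Y, _, _, hs⟩
    exact hs
  · rintro b ⟨Y, hY, hb, hbt⟩
    have htot : b ≤ (l.take l.length).sum := by
      have h := List.sum_toFinset (fun x : ℕ => x) hnodup
      have h2 : ∑ y ∈ Y, y ≤ ∑ y ∈ l.toFinset, y := Finset.sum_le_sum_of_subset hY
      simp at h
      rw [List.take_length]
      omega
    have hex : ∃ j, b ≤ (l.take j).sum := ⟨_, htot⟩
    classical
    have hspec := Nat.find_spec hex
    have hmin : ∀ k, k < Nat.find hex → ¬ b ≤ (l.take k).sum := fun k hk => Nat.find_min hex hk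
    have hle : Nat.find hex ≤ l.length := Nat.find_min' hex htot
    generalize Nat.find hex = j at hspec hmin hle
    cases j with
    | zero =>
      have hb0 : b = 0 := by simpa using hspec
      refine ⟨0, Or.inr ⟨⟨0, by simp, by simp⟩, by simp⟩, 0,
        Or.inr ⟨⟨0, by simp, by simp⟩, by simp⟩, by omega, by omega, by omega⟩
    | succ k =>
      have hk := hmin k (by omega)
      have hkl : k < l.length := by omega
      have hstep : (l.take (k + 1)).sum = (l.take k).sum + l[k] := List.sum_take_succ l k hkl
      have hΔ : l[k] ≤ Δ := hXΔ _ (by simp)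
      have hkt : (l.take k).sum ≤ t := by omega
      refine ⟨(l.take k).sum, Or.inr ⟨⟨k, hkl.le, rfl⟩, hkt⟩, ?_⟩
      by_cases ht : (l.take (k + 1)).sum ≤ t
      · exact ⟨_, Or.inr ⟨⟨k + 1, hle, rfl⟩, ht⟩, by omega, hspec, by omega⟩
      · exact ⟨t + 1, Or.inl rfl, by omega, by omega, by omega⟩
end

section
/- Color-coding containment: Let t be a natural number and let X ⊆ ℕ be a finite set partitioned into pairwise disjoint parts X₁, …, X_m. Set X'_j := X_j ∪ {0} and let T := X'_1 +_t X'_2 +_t ⋯ +_t X'_m (capping after each addition; equivalently, T = (X'_1 + ⋯ + X'_m) ∩ [t]). Then: (i) T ⊆ S(X;t); and (ii) for every subset Y ⊆ X with Σ(Y) ≤ t such that |Y ∩ X_j| ≤ 1 for every j (i.e., the partition splits Y), one has Σ(Y) ∈ T. -/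
/-- The capped sumset `T = (X'_1 + ⋯ + X'_m) ∩ [t]`, where `X'_j = X_j ∪ {0}`:
sums obtained by picking one element of `X_j ∪ {0}` from each part. -/
def colorCodingSumset (t m : ℕ) (X : Fin m → Finset ℕ) : Set ℕ :=
  {s | ∃ f : Fin m → ℕ, (∀ j, f j ∈ insert 0 (X j)) ∧ s = ∑ j, f j} ∩ Set.Iic t

theorem color_coding_containment (t m : ℕ) (X : Fin m → Finset ℕ)
    (hdisj : ∀ j j' : Fin m, j ≠ j' → Disjoint (X j) (X j')) :
    colorCodingSumset t m X ⊆ SubsetSums (Finset.univ.biUnion X) t ∧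
    ∀ Y ⊆ Finset.univ.biUnion X, (∑ y ∈ Y, y) ≤ t →
      (∀ j : Fin m, (Y ∩ X j).card ≤ 1) →
      (∑ y ∈ Y, y) ∈ colorCodingSumset t m X := by
  constructor
  · rintro s ⟨⟨f, hf, rfl⟩, hs⟩
    have hX : ∀ j, f j ≠ 0 → f j ∈ X j := fun j hj =>
      (Finset.mem_insert.mp (hf j)).resolve_left hj
    refine ⟨(Finset.univ.filter (fun j => f j ≠ 0)).image f, ?_, ?_, hs⟩
    · intro y hy
      obtain ⟨j, hj, rfl⟩ := Finset.mem_image.mp hy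
      exact Finset.mem_biUnion.mpr ⟨j, Finset.mem_univ j, hX j (Finset.mem_filter.mp hj).2⟩
    · rw [Finset.sum_image]
      · exact Finset.sum_filter_ne_zero Finset.univ
      · intro a ha b hb hab
        by_contra hne
        have ha' : f a ≠ 0 := by simpa using ha
        have hb' : f b ≠ 0 := by simpa using hb
        have h1 := hX a ha'
        have h2 := hX b hb'
        rw [← hab] at h2
        exact Finset.disjoint_left.mp (hdisj a b hne) h1 h2
  · intro Y hY ht hc
    refine ⟨⟨fun j => ∑ y ∈ Y ∩ X j, y, ?_, ?_⟩, ht⟩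
    · intro j
      rcases Finset.card_le_one_iff_subset_singleton.mp (hc j) with ⟨a, ha⟩
      rcases Finset.subset_singleton_iff.mp ha with h | h
      · simp [h]
      · have : a ∈ Y ∩ X j := by simp [h]
        simp only [h, Finset.sum_singleton]
        exact Finset.mem_insert_of_mem (Finset.mem_inter.mp this).2
    · have hU : Y = Finset.univ.biUnion (fun j => Y ∩ X j) := by
        rw [← Finset.inter_biUnion]
        exact (Finset.inter_eq_left.mpr hY).symm
      conv_lhs => rw [hU]
      apply Finset.sum_biUnion
      intro a _ b _ hab
      exact (hdisj a b hab).mono Finset.inter_subset_right Finset.inter_subset_right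
end

section
/- Packing several Min-Plus-Convolution instances into one: Let m ≥ 1 and M ≥ 1 be integers, and let n₁ ≥ n₂ ≥ ⋯ ≥ n_m ≥ 1 be integers with prefix sums s_r := n₁ + ⋯ + n_{r−1} (so s₁ = 0) and s := s_{m+1}. For each 1 ≤ r ≤ m let A_r, B_r be sequences of natural numbers of length n_r with all entries at most M, and let C_r[k] := min_{i+j=k, 0 ≤ i,j < n_r} (A_r[i] + B_r[j]) for 0 ≤ k < n_r. Define sequences A, B of length 4s with values in ℕ ∪ {∞} by A[2s_r + i] := r²·2M + A_r[i] and B[2s_r + j] := r²·2M + B_r[j] for 1 ≤ r ≤ m, 0 ≤ i, j < n_r, and A[p] = B[p] := ∞ for all other indices p. Let C[k] := min_{i+j=k, 0 ≤ i,j < 4s} (A[i] + B[j]). Then for every 1 ≤ r ≤ m and every 0 ≤ k < n_r, C[4s_r + k] = r²·4M + C_r[k]. -/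
lemma packing_mono (n s : ℕ → ℕ) (hs : ∀ r, s (r + 1) = s r + n r) {a b : ℕ} (h : a ≤ b) :
    s a ≤ s b := by
  have : Monotone s := monotone_nat_of_le_succ (fun r => by rw [hs]; omega)
  exact this h

lemma packing_concave (m : ℕ) (n s : ℕ → ℕ) (hs : ∀ r, s (r + 1) = s r + n r)
    (hsorted : ∀ r r', r ≤ r' → r' < m → n r' ≤ n r) (r d : ℕ) (hd : d ≤ r) (hm : r + d ≤ m) :
    s (r + d) + s (r - d) ≤ 2 * s r := by
  induction d with
  | zero => simp; omega
  | succ d ih =>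
    have h := ih (by omega) (by omega)
    have h1 := hs (r + d)
    have h2 := hs (r - (d + 1))
    have h3 := hsorted (r - (d + 1)) (r + d) (by omega) (by omega)
    have h4 : r - (d + 1) + 1 = r - d := by omega
    rw [h4] at h2
    rw [← Nat.add_assoc]
    omega

lemma packing_gap (m : ℕ) (n s : ℕ → ℕ) (hs : ∀ r, s (r + 1) = s r + n r)
    (hsorted : ∀ r r', r ≤ r' → r' < m → n r' ≤ n r) (p q r : ℕ) (hpq : p ≤ q) (hq : q < m)
    (h : p + q < 2 * r) : s p + s q + n p ≤ 2 * s r := by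
  have h1 := hs p
  rcases le_total q r with hqr | hqr
  · have h2 := packing_mono n s hs hqr
    have h3 := packing_mono n s hs (show p + 1 ≤ r by omega)
    omega
  · have h2 := packing_concave m n s hs hsorted r (q - r) (by omega) (by omega)
    have h3 := packing_mono n s hs (show p + 1 ≤ r - (q - r) by omega)
    rw [show r + (q - r) = q by omega] at h2
    omega

lemma packing_sq (p q r : ℕ) (h : 2 * r ≤ p + q) (hne : ¬ (p = r ∧ q = r)) :
    2 * (r + 1) ^ 2 + 1 ≤ (p + 1) ^ 2 + (q + 1) ^ 2 := by
  by_cases hpq : p = q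
  · subst hpq
    have : r + 1 ≤ p := by omega
    nlinarith
  · zify at *
    have h1 : (1 : ℤ) ≤ ((p : ℤ) - q) ^ 2 := by
      have : ((p : ℤ) - q) ≠ 0 := by omega
      have := sq_pos_of_ne_zero this
      omega
    nlinarith

theorem packing_minconv_instances
    (m M : ℕ) (hm : 1 ≤ m) (hM : 1 ≤ M)
    (n : ℕ → ℕ) (hn1 : ∀ r, r < m → 1 ≤ n r)
    (hsorted : ∀ r r', r ≤ r' → r' < m → n r' ≤ n r)
    (s : ℕ → ℕ) (hs : ∀ r, s r = ∑ i ∈ Finset.range r, n i)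
    (A B : ℕ → ℕ → ℕ)
    (hA : ∀ r, r < m → ∀ i, i < n r → A r i ≤ M)
    (hB : ∀ r, r < m → ∀ j, j < n r → B r j ≤ M)
    (bigA bigB : ℕ → ℕ∞)
    (hbigA : ∀ r, r < m → ∀ i, i < n r →
      bigA (2 * s r + i) = (((r + 1) ^ 2 * (2 * M) + A r i : ℕ) : ℕ∞))
    (hbigB : ∀ r, r < m → ∀ j, j < n r →
      bigB (2 * s r + j) = (((r + 1) ^ 2 * (2 * M) + B r j : ℕ) : ℕ∞))
    (hbigA' : ∀ p, (¬ ∃ r, r < m ∧ ∃ i, i < n r ∧ p = 2 * s r + i) → bigA p = ⊤)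
    (hbigB' : ∀ p, (¬ ∃ r, r < m ∧ ∃ j, j < n r ∧ p = 2 * s r + j) → bigB p = ⊤)
    (C : ℕ → ℕ∞)
    (hC : ∀ k, C k = sInf {x : ℕ∞ |
      ∃ i j, i < 4 * s m ∧ j < 4 * s m ∧ i + j = k ∧ x = bigA i + bigB j}) :
    ∀ r, r < m → ∀ k, k < n r →
      C (4 * s r + k) = (((r + 1) ^ 2 * (4 * M) : ℕ) : ℕ∞) +
        sInf {x : ℕ∞ | ∃ i j, i < n r ∧ j < n r ∧ i + j = k ∧
          x = ((A r i + B r j : ℕ) : ℕ∞)} := by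
  have hs' : ∀ r, s (r + 1) = s r + n r := fun r => by
    rw [hs, hs, Finset.sum_range_succ]
  intro r hr k hk
  set T := {x : ℕ∞ | ∃ i j, i < n r ∧ j < n r ∧ i + j = k ∧
          x = ((A r i + B r j : ℕ) : ℕ∞)} with hT
  have hne : T.Nonempty := ⟨_, 0, k, by omega, hk, by omega, rfl⟩
  obtain ⟨i0, j0, hi0, hj0, hij0, hx0⟩ : sInf T ∈ T := csInf_mem hne
  have hsm := packing_mono n s hs' (show r + 1 ≤ m by omega)
  have hsr := hs' r
  rw [hC]
  apply le_antisymm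
  · apply sInf_le
    refine ⟨2 * s r + i0, 2 * s r + j0, by omega, by omega, by omega, ?_⟩
    rw [hx0, hbigA r hr i0 hi0, hbigB r hr j0 hj0]
    norm_cast
    ring
  · apply le_sInf
    rintro x ⟨a, b, -, -, hab, rfl⟩
    by_cases ha : ∃ r, r < m ∧ ∃ i, i < n r ∧ a = 2 * s r + i
    swap
    · rw [hbigA' a ha]; simp
    by_cases hb : ∃ r, r < m ∧ ∃ i, i < n r ∧ b = 2 * s r + i
    swap
    · rw [hbigB' b hb]; simp
    obtain ⟨p, hp, i, hi, rfl⟩ := ha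
    obtain ⟨q, hq, j, hj, rfl⟩ := hb
    rw [hbigA p hp i hi, hbigB q hq j hj]
    by_cases hpq : p = r ∧ q = r
    · obtain ⟨rfl, rfl⟩ := hpq
      have h1 : sInf T ≤ ((A q i + B q j : ℕ) : ℕ∞) :=
        sInf_le ⟨i, j, hi, hj, by omega, rfl⟩
      refine (add_le_add le_rfl h1).trans (le_of_eq ?_)
      norm_cast
      ring
    · have hle : 2 * r ≤ p + q := by
        by_contra hlt
        rcases le_total p q with h | h
        · have h1 := packing_gap m n s hs' hsorted p q r h hq (by omega)
          have h2 := hsorted p q h hq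
          omega
        · have h1 := packing_gap m n s hs' hsorted q p r h hp (by omega)
          have h2 := hsorted q p h hp
          omega
      have h3 := packing_sq p q r hle hpq
      have h4 := Nat.mul_le_mul_right (2 * M) h3
      have h5 := hA r hr i0 hi0
      have h6 := hB r hr j0 hj0
      rw [hx0]
      norm_cast
      nlinarith
end

section
/- Correctness of the reduction from Knapsack to gap-approximate SubsetSum: Let n ≥ 1 and M ≥ 1 be integers, and set M' := 4nM. Let w₁, …, wₙ be natural numbers and v₁, …, vₙ be integers with |vᵢ| ≤ M for all i. Let W ≥ 1 and 1 ≤ V ≤ M be integers, and define xᵢ := wᵢ·M' − vᵢ (an integer), t := W·M' − V, and ε := 1/(2W) (a rational number). Suppose there is no subset S ⊆ {1,…,n} with Σ_{i∈S} wᵢ = W and Σ_{i∈S} vᵢ ≥ V. Then for every subset S ⊆ {1,…,n}, either Σ_{i∈S} xᵢ > t, or Σ_{i∈S} xᵢ < (1 − ε)·t, where the latter inequality is between rational numbers. -/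
theorem knapsack_to_gap_subset_sum
    (n M : ℕ) (hn : 1 ≤ n) (hM : 1 ≤ M)
    (w : Fin n → ℕ) (v : Fin n → ℤ) (hv : ∀ i, |v i| ≤ (M : ℤ))
    (W V : ℕ) (hW : 1 ≤ W) (hV1 : 1 ≤ V) (hVM : V ≤ M)
    (hno : ¬ ∃ S : Finset (Fin n), (∑ i ∈ S, w i) = W ∧ (V : ℤ) ≤ ∑ i ∈ S, v i) :
    ∀ S : Finset (Fin n),
      (W : ℤ) * (4 * n * M) - V < ∑ i ∈ S, ((w i : ℤ) * (4 * n * M) - v i) ∨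
      ((∑ i ∈ S, ((w i : ℤ) * (4 * n * M) - v i) : ℤ) : ℚ) <
        (1 - 1 / (2 * (W : ℚ))) * (((W : ℤ) * (4 * n * M) - V : ℤ) : ℚ) := by
  intro S
  have hb : |∑ i ∈ S, v i| ≤ (n : ℤ) * M := by
    calc |∑ i ∈ S, v i| ≤ ∑ i ∈ S, |v i| := Finset.abs_sum_le_sum_abs _ _
      _ ≤ ∑ i ∈ S, (M : ℤ) := Finset.sum_le_sum fun i _ => hv i
      _ = (S.card : ℤ) * M := by simp
      _ ≤ (n : ℤ) * M := by
        have h : S.card ≤ n := by simpa using S.card_le_univ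
        gcongr
  have hs : ∑ i ∈ S, ((w i : ℤ) * (4 * n * M) - v i)
      = ((∑ i ∈ S, w i : ℕ) : ℤ) * (4 * n * M) - ∑ i ∈ S, v i := by
    rw [Finset.sum_sub_distrib, ← Finset.sum_mul]
    push_cast
    rfl
  have hno' : (∑ i ∈ S, w i) = W → ∑ i ∈ S, v i < (V : ℤ) := by
    intro h
    by_contra hc
    exact hno ⟨S, h, not_lt.mp hc⟩
  rw [hs]
  generalize (∑ i ∈ S, w i) = a at *
  generalize (∑ i ∈ S, v i) = b at *
  obtain ⟨hb1, hb2⟩ := abs_le.mp hb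
  have hnM : (M : ℤ) ≤ n * M := by
    exact_mod_cast Nat.le_mul_of_pos_left M hn
  have hM' : (1 : ℤ) ≤ M := by exact_mod_cast hM
  have hVM' : (V : ℤ) ≤ M := by exact_mod_cast hVM
  have hV' : (1 : ℤ) ≤ V := by exact_mod_cast hV1
  rcases lt_trichotomy a W with h | h | h
  · right
    have h1 : (a : ℤ) + 1 ≤ W := by exact_mod_cast h
    have h2 : ((a : ℤ) + 1) * (4 * n * M) ≤ W * (4 * n * M) :=
      mul_le_mul_of_nonneg_right h1 (by positivity)
    have h3 : (a : ℤ) * (4 * n * M) - b ≤ W * (4 * n * M) - V - 2 * (n * M) := by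
      linarith
    have h4 : (((a : ℤ) * (4 * n * M) - b : ℤ) : ℚ)
        ≤ ((W * (4 * n * M) - V - 2 * (n * M) : ℤ) : ℚ) := by exact_mod_cast h3
    have hWq : (0 : ℚ) < W := by exact_mod_cast hW
    have hVq : (0 : ℚ) < V := by exact_mod_cast hV1
    have h5 : (1 - 1 / (2 * (W : ℚ))) * (((W : ℤ) * (4 * n * M) - V : ℤ) : ℚ)
        = ((W * (4 * n * M) - V - 2 * (n * M) : ℤ) : ℚ) + V / (2 * W) := by
      push_cast
      field_simp
      ring
    have h6 : (0 : ℚ) < V / (2 * W) := by positivity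
    rw [h5]
    linarith
  · left
    have := hno' h
    rw [h]
    linarith
  · left
    have h1 : (W : ℤ) + 1 ≤ a := by exact_mod_cast h
    have h2 : ((W : ℤ) + 1) * (4 * n * M) ≤ a * (4 * n * M) :=
      mul_le_mul_of_nonneg_right h1 (by positivity)
    linarith
end

section
/- Knapsack item pruning: Let I be a finite index set of items with weights wᵢ and values vᵢ, where each wᵢ ∈ {1,…,W} and vᵢ ∈ ℕ for a positive integer W. Suppose K ⊆ I satisfies, for every weight w ∈ {1,…,W}: (a) |{i ∈ K : wᵢ = w}| ≥ min(⌊W/w⌋, |{i ∈ I : wᵢ = w}|), and (b) for all i ∈ K and j ∈ I ∖ K with wᵢ = w_j = w one has v_j ≤ vᵢ (the kept items of each weight are among the most valuable). Then for every S ⊆ I with Σ_{i∈S} wᵢ ≤ W there exists S' ⊆ K with Σ_{i∈S'} wᵢ ≤ W and Σ_{i∈S'} vᵢ ≥ Σ_{i∈S} vᵢ. In particular, restricting the item set to K does not change the optimal Knapsack value. -/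
theorem knapsack_item_pruning {ι : Type*} [DecidableEq ι]
    (W : ℕ) (hW : 0 < W) (I K : Finset ι) (w v : ι → ℕ)
    (hw : ∀ i ∈ I, 1 ≤ w i ∧ w i ≤ W) (hKI : K ⊆ I)
    (ha : ∀ u, 1 ≤ u → u ≤ W →
      min (W / u) ((I.filter (fun i => w i = u)).card) ≤
        (K.filter (fun i => w i = u)).card)
    (hb : ∀ u, 1 ≤ u → u ≤ W →
      ∀ i ∈ K, ∀ j ∈ I \ K, w i = u → w j = u → v j ≤ v i) :
    ∀ S ⊆ I, (∑ i ∈ S, w i) ≤ W →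
      ∃ S' ⊆ K, (∑ i ∈ S', w i) ≤ W ∧ (∑ i ∈ S, v i) ≤ ∑ i ∈ S', v i := by
  intro S
  induction hn : (S \ K).card generalizing S with
  | zero =>
    intro _ hSW
    exact ⟨S, Finset.sdiff_eq_empty_iff_subset.mp (Finset.card_eq_zero.mp hn), hSW, le_rfl⟩
  | succ n ih =>
    intro hSI hSW
    obtain ⟨j, hj⟩ : (S \ K).Nonempty := Finset.card_pos.mp (by omega)
    obtain ⟨hjS, hjK⟩ := Finset.mem_sdiff.mp hj
    obtain ⟨h1, h2⟩ := hw j (hSI hjS)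
    -- the number of items of weight `w j` in `S` is at most that in `K`
    have hc1 : (S.filter (fun i => w i = w j)).card ≤ W / w j := by
      rw [Nat.le_div_iff_mul_le h1]
      calc (S.filter (fun i => w i = w j)).card * w j
          = ∑ i ∈ S.filter (fun i => w i = w j), w i := by
            rw [Finset.sum_congr rfl (fun i hi => (Finset.mem_filter.mp hi).2)]
            simp
        _ ≤ ∑ i ∈ S, w i :=
            Finset.sum_le_sum_of_subset (Finset.filter_subset _ _)
        _ ≤ W := hSW
    have hc2 : (S.filter (fun i => w i = w j)).card ≤ (I.filter (fun i => w i = w j)).card :=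
      Finset.card_le_card (Finset.filter_subset_filter _ hSI)
    have hc3 := (le_min hc1 hc2).trans (ha (w j) h1 h2)
    -- hence some item of `K` of that weight is unused
    obtain ⟨i, hiK, hiw, hiS⟩ : ∃ i ∈ K, w i = w j ∧ i ∉ S := by
      by_contra! hcon
      have hss : K.filter (fun i => w i = w j) ⊂ S.filter (fun i => w i = w j) := by
        rw [Finset.ssubset_iff_of_subset]
        · exact ⟨j, by simp [hjS], by simp [hjK]⟩
        · intro i hi
          rw [Finset.mem_filter] at hi ⊢
          exact ⟨hcon i hi.1 hi.2, hi.2⟩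
      have := Finset.card_lt_card hss
      omega
    have hv : v j ≤ v i :=
      hb (w j) h1 h2 i hiK j (Finset.mem_sdiff.mpr ⟨hSI hjS, hjK⟩) hiw rfl
    have hiE : i ∉ S.erase j := fun h => hiS (Finset.mem_of_mem_erase h)
    have hsw := Finset.add_sum_erase S w hjS
    have hsv := Finset.add_sum_erase S v hjS
    have hiw' := Finset.sum_insert (f := w) hiE
    have hiv' := Finset.sum_insert (f := v) hiE
    have hcard : (insert i (S.erase j) \ K).card = n := by
      rw [Finset.insert_sdiff_of_mem _ hiK, Finset.erase_sdiff_comm,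
        Finset.card_erase_of_mem hj]
      omega
    obtain ⟨S', hS'K, hS'W, hS'v⟩ := ih (insert i (S.erase j)) hcard
      (Finset.insert_subset (hKI hiK) ((Finset.erase_subset _ _).trans hSI)) (by omega)
    exact ⟨S', hS'K, hS'W, by omega⟩
end
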